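/- There exists an absolute constant C > 0 with the following property: for every probability space (X, 𝓕, μ) with an invertible ergodic measure-preserving transformation T : X → X, all real-valued f₁, f₂ ∈ L^∞(μ) with ‖f₁‖_∞ ≤ 1 and ‖f₂‖_∞ ≤ 1, and all integers a ≠ 0 and b, one has ∫∫ limsup_{N→∞} | (1/N) ∑_{n=1}^{N} f₁(T^{an}x) f₂(T^{bn}y) |² d(μ⊗μ)(x,y) ≤ C |a| ⦀f₁⦀₂². -/

import Mathlib

open MeasureTheory Filter

/-- The 4th power of the Host–Kra seminorm `⦀f⦀₂`. -/
noncomputable def hkSeminorm2pow4 {X : Type*} [MeasurableSpace X] (μ : Measure X)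
    (T : X → X) (f : X → ℝ) : ℝ :=
  limsup (fun H : ℕ => (1 / (H : ℝ)) * ∑ h ∈ Finset.Icc 1 H,
    |∫ x, f x * f (T^[h] x) ∂μ| ^ 2) atTop

open scoped Topology

/-- A sequence dominated by another one up to a null sequence has the smaller upper limit. -/
theorem limsup_le_limsup_of_le_add_tendsto_zero {u v e : ℕ → ℝ}
    (hu : ∀ n, 0 ≤ u n) {K : ℝ} (hv : ∀ n, v n ≤ K)
    (huv : ∀ n, u n ≤ v n + e n) (he : Tendsto e atTop (𝓝 0)) :
    limsup u atTop ≤ limsup v atTop := by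
  have hub : IsCoboundedUnder (· ≤ ·) atTop u :=
    (isBoundedUnder_of ⟨0, fun n => hu n⟩ : IsBoundedUnder (· ≥ ·) atTop u).isCoboundedUnder_le
  have hvb : IsBoundedUnder (· ≤ ·) atTop v := isBoundedUnder_of ⟨K, hv⟩
  refine le_of_forall_pos_le_add fun ε hε => ?_
  have h1 : ∀ᶠ n in atTop, v n < limsup v atTop + ε / 2 :=
    eventually_lt_of_limsup_lt (by linarith) hvb
  have h2 : ∀ᶠ n in atTop, e n < ε / 2 := he.eventually_lt_const (by positivity)
  refine limsup_le_of_le hub ?_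
  filter_upwards [h1, h2] with n h1 h2
  linarith [huv n]

variable {Y : Type*}

theorem birkhoffAverage_mem_Icc (S : Y → Y) {g : Y → ℝ} (hg0 : ∀ x, 0 ≤ g x)
    (hg1 : ∀ x, g x ≤ 1) (n : ℕ) (x : Y) :
    0 ≤ birkhoffAverage ℝ S g n x ∧ birkhoffAverage ℝ S g n x ≤ 1 := by
  have h0 : 0 ≤ birkhoffSum S g n x := Finset.sum_nonneg fun _ _ => hg0 _
  have h1 : birkhoffSum S g n x ≤ n := by
    simpa [birkhoffSum] using Finset.sum_le_card_nsmul (Finset.range n) (fun k => g (S^[k] x)) 1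
      fun _ _ => hg1 _
  simp only [birkhoffAverage, smul_eq_mul]
  refine ⟨by positivity, ?_⟩
  rw [inv_mul_eq_div]
  exact div_le_one_of_le₀ h1 (Nat.cast_nonneg n)

theorem abs_birkhoffAverage_le_one (S : Y → Y) {F : Y → ℝ} (hF : ∀ x, |F x| ≤ 1) (n : ℕ)
    (x : Y) : |birkhoffAverage ℝ S F n x| ≤ 1 := by
  have h1 : |birkhoffSum S F n x| ≤ n := by
    refine (Finset.abs_sum_le_sum_abs _ _).trans ?_
    simpa using Finset.sum_le_card_nsmul (Finset.range n) (fun k => |F (S^[k] x)|) 1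
      fun _ _ => hF _
  simp only [birkhoffAverage, smul_eq_mul]
  rw [inv_mul_eq_div, abs_div, Nat.abs_cast]
  exact div_le_one_of_le₀ h1 (Nat.cast_nonneg n)

theorem tendsto_birkhoffAverage_iterate_sub (S : Y → Y) {F : Y → ℝ} (hF : ∀ x, |F x| ≤ 1)
    (m : ℕ) (x : Y) :
    Tendsto (fun n => birkhoffAverage ℝ S F n (S^[m] x) - birkhoffAverage ℝ S F n x)
      atTop (𝓝 0) := by
  have hb : Bornology.IsBounded (Set.range F) :=
    isBounded_iff_forall_norm_le.2 ⟨1, by rintro _ ⟨x, rfl⟩; exact hF x⟩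
  induction m with
  | zero => simp
  | succ m ih =>
    have := (tendsto_birkhoffAverage_apply_sub_birkhoffAverage' ℝ hb S (S^[m] x)).add ih
    simpa [Function.iterate_succ_apply'] using this

theorem limsup_birkhoffAverage_apply (S : Y → Y) {g : Y → ℝ} (hg0 : ∀ x, 0 ≤ g x)
    (hg1 : ∀ x, g x ≤ 1) (x : Y) :
    limsup (fun n => birkhoffAverage ℝ S g n (S x)) atTop =
      limsup (fun n => birkhoffAverage ℝ S g n x) atTop := by
  have hg : ∀ x, |g x| ≤ 1 := fun x => by rw [abs_of_nonneg (hg0 x)]; exact hg1 x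
  have h := tendsto_birkhoffAverage_iterate_sub S hg 1 x
  have hb := birkhoffAverage_mem_Icc S hg0 hg1
  refine le_antisymm
    (limsup_le_limsup_of_le_add_tendsto_zero (fun n => (hb n _).1)
      (fun n => (hb n _).2) (fun n => by simp) h)
    (limsup_le_limsup_of_le_add_tendsto_zero (fun n => (hb n _).1)
      (fun n => (hb n _).2)
      (e := fun n => -(birkhoffAverage ℝ S g n (S^[1] x) - birkhoffAverage ℝ S g n x))
      (fun n => by simp) (by simpa using h.neg))

/-- If every orbit is covered by blocks of length at most `M` on which the sums of `h` are
nonnegative, then all its Birkhoff sums are bounded below. -/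
theorem neg_le_birkhoffSum_of_blocks {S : Y → Y} {h : Y → ℝ} {M : ℕ} (hh : ∀ x, -1 ≤ h x)
    (hblock : ∀ x, ∃ n, 1 ≤ n ∧ n ≤ M ∧ 0 ≤ birkhoffSum S h n x) (L : ℕ) (x : Y) :
    -(M : ℝ) ≤ birkhoffSum S h L x := by
  induction L using Nat.strong_induction_on generalizing x with
  | _ L ih =>
    rcases le_or_gt L M with hL | hL
    · have h1 : -(L : ℝ) ≤ birkhoffSum S h L x := by
        simpa [birkhoffSum] using Finset.card_nsmul_le_sum (Finset.range L)
          (fun k => h (S^[k] x)) (-1) fun _ _ => hh _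
      have : (L : ℝ) ≤ M := by exact_mod_cast hL
      linarith
    · obtain ⟨n, hn1, hnM, hn⟩ := hblock x
      have h2 := ih (L - n) (by omega) (S^[n] x)
      have h3 := birkhoffSum_add S h n (L - n) x
      rw [show n + (L - n) = L by omega] at h3
      linarith

/-- Replacing `F` by its own Birkhoff average does not change the asymptotic averages. -/
theorem tendsto_birkhoffAverage_sub_birkhoffAverage_birkhoffAverage (S : Y → Y) {F : Y → ℝ}
    (hF : ∀ x, |F x| ≤ 1) {M : ℕ} (hM : M ≠ 0) (x : Y) :
    Tendsto (fun n => birkhoffAverage ℝ S (birkhoffAverage ℝ S F M) n x -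
      birkhoffAverage ℝ S F n x) atTop (𝓝 0) := by
  have h : Tendsto (fun n => (M : ℝ)⁻¹ * ∑ m ∈ Finset.range M,
      (birkhoffAverage ℝ S F n (S^[m] x) - birkhoffAverage ℝ S F n x)) atTop (𝓝 0) := by
    simpa using (tendsto_finsetSum (Finset.range M) fun m _ =>
      tendsto_birkhoffAverage_iterate_sub S hF m x).const_mul (M : ℝ)⁻¹
  refine h.congr fun n => ?_
  have hM' : (M : ℝ) ≠ 0 := by exact_mod_cast hM
  rw [Finset.sum_sub_distrib, mul_sub]
  congr 1
  · simp only [birkhoffAverage, birkhoffSum, smul_eq_mul, ← Finset.mul_sum]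
    rw [Finset.sum_comm]
    simp only [← Function.iterate_add_apply, add_comm]
    ring
  · simp [hM']

theorem sq_birkhoffAverage_le (S : Y → Y) (G : Y → ℝ) (n : ℕ) (x : Y) :
    birkhoffAverage ℝ S G n x ^ 2 ≤ birkhoffAverage ℝ S (fun y => G y ^ 2) n x := by
  rcases Nat.eq_zero_or_pos n with rfl | hn
  · simp
  have hn0 : (0 : ℝ) < n := by exact_mod_cast hn
  have := sq_sum_le_card_mul_sum_sq (s := Finset.range n) (f := fun k => G (S^[k] x))
  simp only [birkhoffAverage, birkhoffSum, smul_eq_mul, Finset.card_range] at *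
  rw [mul_pow, inv_mul_eq_div, inv_pow, inv_mul_eq_div, div_le_div_iff₀ (by positivity) hn0]
  nlinarith

theorem limsup_sq_birkhoffAverage_le (S : Y → Y) {F : Y → ℝ} (hF : ∀ x, |F x| ≤ 1) {M : ℕ}
    (hM : M ≠ 0) (x : Y) :
    limsup (fun n => birkhoffAverage ℝ S F n x ^ 2) atTop ≤
      limsup (fun n => birkhoffAverage ℝ S (fun y => birkhoffAverage ℝ S F M y ^ 2) n x) atTop := by
  have hA := abs_birkhoffAverage_le_one S hF
  have hlim : Tendsto (fun n => 2 * |birkhoffAverage ℝ S (birkhoffAverage ℝ S F M) n x -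
      birkhoffAverage ℝ S F n x|) atTop (𝓝 0) := by
    simpa using
      (tendsto_birkhoffAverage_sub_birkhoffAverage_birkhoffAverage S hF hM x).abs.const_mul 2
  refine limsup_le_limsup_of_le_add_tendsto_zero (fun n => sq_nonneg _) (K := 1)
    (fun n => (birkhoffAverage_mem_Icc S (fun y => sq_nonneg _)
      (fun y => (sq_le_one_iff_abs_le_one _).2 (hA M y)) n x).2) (fun n => ?_) hlim
  have h1 := sq_birkhoffAverage_le S (birkhoffAverage ℝ S F M) n x
  have h2 := abs_le.1 (hA n x)
  have h3 := abs_le.1 (abs_birkhoffAverage_le_one S (hA M) n x)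
  refine le_trans ?_ (add_le_add_left h1 _)
  generalize birkhoffAverage ℝ S (birkhoffAverage ℝ S F M) n x = B at *
  generalize birkhoffAverage ℝ S F n x = A at *
  rcases abs_cases (B - A) with ⟨h, _⟩ | ⟨h, _⟩ <;> rw [h] <;> nlinarith

theorem sum_sum_dist_le {d : ℕ → ℝ} (hd : ∀ k, 0 ≤ d k) (M : ℕ) :
    ∑ n ∈ Finset.range M, ∑ m ∈ Finset.range M, d (Nat.dist n m) ≤
      2 * M * ∑ k ∈ Finset.range M, d k := by
  have hrow : ∀ n ∈ Finset.range M, ∑ m ∈ Finset.range M, d (Nat.dist n m) ≤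
      2 * ∑ k ∈ Finset.range M, d k := by
    intro n hn
    rw [Finset.mem_range] at hn
    have hsplit := Finset.sum_filter_add_sum_filter_not (Finset.range M) (fun m => m ≤ n)
      (fun m => d (Nat.dist n m))
    have hinj : ∀ s : Finset ℕ, s ⊆ Finset.range M → Set.InjOn (Nat.dist n) s →
        ∑ m ∈ s, d (Nat.dist n m) ≤ ∑ k ∈ Finset.range M, d k := by
      intro s hs hi
      rw [← Finset.sum_image (f := d) hi]
      refine Finset.sum_le_sum_of_subset_of_nonneg (fun k hk => ?_) fun _ _ _ => hd _
      obtain ⟨m, hm, rfl⟩ := Finset.mem_image.1 hk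
      have := Finset.mem_range.1 (hs hm)
      simp only [Nat.dist, Finset.mem_range]
      omega
    have h1 := hinj _ (Finset.filter_subset (fun m => m ≤ n) _) fun i hi j hj hij => by
      simp only [Nat.dist, Finset.coe_filter, Set.mem_ofPred_eq] at *; omega
    have h2 := hinj _ (Finset.filter_subset (fun m => ¬ m ≤ n) _) fun i hi j hj hij => by
      simp only [Nat.dist, Finset.coe_filter, Set.mem_ofPred_eq] at *; omega
    linarith
  refine (Finset.sum_le_sum hrow).trans (le_of_eq ?_)
  simp
  ring

theorem iterate_prodMap_zpow (T : Equiv.Perm Y) (a b : ℤ) (n : ℕ) (p : Y × Y) :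
    (Prod.map ⇑(T ^ a) ⇑(T ^ b))^[n] p = ((T ^ (a * n)) p.1, (T ^ (b * n)) p.2) := by
  rw [Prod.map_iterate, Equiv.Perm.iterate_eq_pow, Equiv.Perm.iterate_eq_pow, zpow_mul, zpow_mul,
    zpow_natCast, zpow_natCast]
  rfl

variable [MeasurableSpace Y]

theorem measurable_birkhoffAverage {S : Y → Y} (hS : Measurable S) {F : Y → ℝ}
    (hF : Measurable F) (n : ℕ) : Measurable (birkhoffAverage ℝ S F n) := by
  have : Measurable (birkhoffSum S F n) :=
    Finset.measurable_fun_sum _ fun k _ => hF.comp (hS.iterate k)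
  exact this.const_smul (n : ℝ)⁻¹

theorem integral_comp_of_measurePreserving {Z : Type*} [MeasurableSpace Z] {ν : Measure Y}
    {ρ : Measure Z} {S : Y → Z} (hS : MeasurePreserving S ν ρ) {g : Z → ℝ} (hg : Measurable g) :
    ∫ x, g (S x) ∂ν = ∫ x, g x ∂ρ := by
  rw [← hS.map_eq, integral_map hS.measurable.aemeasurable hg.aestronglyMeasurable]

theorem integrable_of_abs_le_one {ν : Measure Y} [IsFiniteMeasure ν] {g : Y → ℝ}
    (hg : Measurable g) (hg1 : ∀ x, |g x| ≤ 1) : Integrable g ν :=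
  Integrable.of_bound hg.aestronglyMeasurable 1 (ae_of_all _ hg1)

theorem integral_birkhoffSum {ν : Measure Y} [IsFiniteMeasure ν] {S : Y → Y}
    (hS : MeasurePreserving S ν ν) {h : Y → ℝ} (hm : Measurable h) (hi : Integrable h ν) (L : ℕ) :
    ∫ x, birkhoffSum S h L x ∂ν = L * ∫ x, h x ∂ν := by
  simp only [birkhoffSum]
  have hk : ∀ k, Integrable (fun x => h (S^[k] x)) ν := fun k =>
    (hS.iterate k).integrable_comp_of_integrable hi
  rw [integral_finsetSum _ fun k _ => hk k]
  simp [integral_comp_of_measurePreserving (hS.iterate _) hm]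

/-- The upper limit of Birkhoff averages of `g` has integral at most that of `g`. -/
theorem integral_limsup_birkhoffAverage_le {ν : Measure Y} [IsProbabilityMeasure ν] {S : Y → Y}
    (hS : MeasurePreserving S ν ν) {g : Y → ℝ} (hg : Measurable g) (hg0 : ∀ x, 0 ≤ g x)
    (hg1 : ∀ x, g x ≤ 1) :
    ∫ x, limsup (fun n => birkhoffAverage ℝ S g n x) atTop ∂ν ≤ ∫ x, g x ∂ν := by
  set φ : Y → ℝ := fun x => limsup (fun n => birkhoffAverage ℝ S g n x) atTop with hφ
  have hb := birkhoffAverage_mem_Icc S hg0 hg1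
  have hcob : ∀ x, IsCoboundedUnder (· ≤ ·) atTop (fun n => birkhoffAverage ℝ S g n x) := fun x =>
    (isBoundedUnder_of ⟨0, fun n => (hb n x).1⟩ : IsBoundedUnder (· ≥ ·) atTop
      (fun n => birkhoffAverage ℝ S g n x)).isCoboundedUnder_le
  have hφm : Measurable φ := Measurable.limsup fun n =>
    measurable_birkhoffAverage hS.measurable hg n
  have hφ1 : ∀ x, φ x ≤ 1 := fun x =>
    limsup_le_of_le (hcob x) (Eventually.of_forall fun n => (hb n x).2)
  have hφ0 : ∀ x, 0 ≤ φ x := fun x =>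
    le_limsup_of_frequently_le (Frequently.of_forall fun n => (hb n x).1)
      (isBoundedUnder_of ⟨1, fun n => (hb n x).2⟩)
  have hφi : φ ∘ S = φ := funext fun x => limsup_birkhoffAverage_apply S hg0 hg1 x
  have hφint : Integrable φ ν := integrable_of_abs_le_one hφm fun x => by
    rw [abs_of_nonneg (hφ0 x)]; exact hφ1 x
  have hgint : Integrable g ν := integrable_of_abs_le_one hg fun x => by
    rw [abs_of_nonneg (hg0 x)]; exact hg1 x
  refine le_of_forall_pos_le_add fun ε hε => ?_
  let h₀ : Y → ℝ := fun x => g x - φ x + ε / 2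
  have hh₀m : Measurable h₀ := (hg.sub hφm).add_const _
  have hsum : ∀ n x, birkhoffSum S h₀ n x = birkhoffSum S g n x - n * (φ x - ε / 2) := by
    intro n x
    have := congrFun (birkhoffSum_of_comp_eq hφi n) x
    simp only [birkhoffSum, Pi.smul_apply, nsmul_eq_mul] at this
    simp only [birkhoffSum, h₀, Finset.sum_add_distrib, Finset.sum_sub_distrib, this]
    simp
    ring
  let E : ℕ → Set Y := fun M => {x | ∀ n ∈ Finset.Icc 1 M, birkhoffSum S h₀ n x < 0}
  have hEm : ∀ M, MeasurableSet (E M) := fun M => by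
    have : E M = ⋂ n ∈ Finset.Icc 1 M, {x | birkhoffSum S h₀ n x < 0} := by ext; simp [E]
    rw [this]
    refine Finset.measurableSet_biInter _ fun n _ => measurableSet_lt ?_ measurable_const
    exact Finset.measurable_fun_sum _ fun k _ => hh₀m.comp (hS.measurable.iterate k)
  have hEa : Antitone E := fun M N hMN x hx n hn =>
    hx n (Finset.Icc_subset_Icc_right hMN hn)
  have hEe : ⋂ M, E M = ∅ := by
    refine Set.eq_empty_of_forall_notMem fun x hx => ?_
    have hfr : ∃ᶠ n in atTop, φ x - ε / 2 < birkhoffAverage ℝ S g n x :=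
      frequently_lt_of_lt_limsup (hcob x) (show φ x - ε / 2 < φ x by linarith)
    obtain ⟨n, hn, hn1⟩ := (hfr.and_eventually (eventually_ge_atTop 1)).exists
    have hneg := Set.mem_iInter.1 hx n n (by simp [hn1])
    have hn0 : (0 : ℝ) < n := by exact_mod_cast hn1
    rw [hsum] at hneg
    rw [birkhoffAverage, smul_eq_mul, inv_mul_eq_div, lt_div_iff₀ hn0] at hn
    linarith
  have hlim : Tendsto (fun M => ν.real (E M)) atTop (𝓝 0) := by
    have := tendsto_measure_iInter_atTop (μ := ν) (fun M => (hEm M).nullMeasurableSet) hEa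
      ⟨0, measure_ne_top _ _⟩
    rw [hEe, measure_empty] at this
    exact (ENNReal.tendsto_toReal ENNReal.zero_ne_top).comp this
  obtain ⟨M, hM, hM1⟩ := ((hlim.eventually_lt_const (half_pos hε)).and
    (eventually_ge_atTop 1)).exists
  let ind : Y → ℝ := (E M).indicator fun _ => 1
  have hind0 : ∀ x, 0 ≤ ind x := fun x => Set.indicator_nonneg (fun _ _ => zero_le_one) x
  have hindm : Measurable ind := measurable_const.indicator (hEm M)
  have hindint : Integrable ind ν := (integrable_const (1 : ℝ)).indicator (hEm M)
  let h : Y → ℝ := fun x => h₀ x + ind x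
  have hh₀int : Integrable h₀ ν := (hgint.sub hφint).add (integrable_const _)
  have hlow : ∀ x, -1 ≤ h x := fun x => by
    have := hg0 x; have := hφ1 x; have := hind0 x
    simp only [h, h₀]; linarith
  have hblock : ∀ x, ∃ n, 1 ≤ n ∧ n ≤ M ∧ 0 ≤ birkhoffSum S h n x := by
    intro x
    by_cases hx : x ∈ E M
    · refine ⟨1, le_rfl, hM1, ?_⟩
      have : ind x = 1 := Set.indicator_of_mem hx _
      have := hg0 x; have := hφ1 x
      simp only [birkhoffSum_one, h, h₀]; linarith
    · simp only [E, Set.mem_ofPred_eq, not_forall, not_lt, Finset.mem_Icc] at hx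
      obtain ⟨n, ⟨hn1, hnM⟩, hn⟩ := hx
      exact ⟨n, hn1, hnM, hn.trans (Finset.sum_le_sum fun k _ => le_add_of_nonneg_right (hind0 _))⟩
  have hhint : Integrable h ν := hh₀int.add hindint
  have hnonneg : 0 ≤ ∫ x, h x ∂ν := by
    by_contra! hlt
    obtain ⟨L, hL⟩ := exists_nat_gt ((M : ℝ) / -∫ x, h x ∂ν)
    rw [div_lt_iff₀ (by linarith)] at hL
    have hmono : ∫ _, -(M : ℝ) ∂ν ≤ ∫ x, birkhoffSum S h L x ∂ν := by
      refine integral_mono (integrable_const _) ?_ (neg_le_birkhoffSum_of_blocks hlow hblock L)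
      exact integrable_finsetSum _ fun k _ => (hS.iterate k).integrable_comp_of_integrable hhint
    have hhm : Measurable h := hh₀m.add hindm
    rw [integral_birkhoffSum hS hhm hhint] at hmono
    simp at hmono
    linarith
  have hval : ∫ x, h x ∂ν = ∫ x, g x ∂ν - ∫ x, φ x ∂ν + ε / 2 + ν.real (E M) := by
    simp only [h]
    rw [integral_add hh₀int hindint, integral_indicator_const _ (hEm M)]
    have hsub : Integrable (fun x => g x - φ x) ν := hgint.sub hφint
    simp only [h₀]
    rw [integral_add hsub (integrable_const _), integral_sub hgint hφint]
    simp
  linarith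

theorem integral_iterate_mul_iterate {ν : Measure Y} {S : Y → Y} (hS : MeasurePreserving S ν ν)
    {F : Y → ℝ} (hF : Measurable F) (n m : ℕ) :
    ∫ x, F (S^[n] x) * F (S^[m] x) ∂ν = ∫ x, F x * F (S^[Nat.dist n m] x) ∂ν := by
  wlog hnm : n ≤ m generalizing n m
  · rw [Nat.dist_comm, ← this m n (by omega)]
    simp only [mul_comm]
  have hG : Measurable fun x => F x * F (S^[Nat.dist n m] x) :=
    hF.mul (hF.comp (hS.measurable.iterate _))
  rw [← integral_comp_of_measurePreserving (hS.iterate n) hG]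
  simp only [← Function.iterate_add_apply, Nat.dist_eq_sub_of_le hnm, Nat.sub_add_cancel hnm]

theorem integral_sq_birkhoffAverage_le {ν : Measure Y} [IsProbabilityMeasure ν] {S : Y → Y}
    (hS : MeasurePreserving S ν ν) {F : Y → ℝ} (hF : Measurable F) (hF1 : ∀ x, |F x| ≤ 1) (M : ℕ) :
    ∫ x, birkhoffAverage ℝ S F M x ^ 2 ∂ν ≤
      2 * ((M : ℝ)⁻¹ * ∑ k ∈ Finset.range M, |∫ x, F x * F (S^[k] x) ∂ν|) := by
  have hint : ∀ n m, Integrable (fun x => F (S^[n] x) * F (S^[m] x)) ν := fun n m =>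
    integrable_of_abs_le_one
      ((hF.comp (hS.measurable.iterate n)).mul (hF.comp (hS.measurable.iterate m)))
      fun x => by rw [abs_mul]; exact mul_le_one₀ (hF1 _) (abs_nonneg _) (hF1 _)
  have hexp : ∫ x, birkhoffAverage ℝ S F M x ^ 2 ∂ν = (M : ℝ)⁻¹ ^ 2 *
      ∑ n ∈ Finset.range M, ∑ m ∈ Finset.range M, ∫ x, F x * F (S^[Nat.dist n m] x) ∂ν := by
    simp only [birkhoffAverage, birkhoffSum, smul_eq_mul, mul_pow]
    rw [integral_const_mul]
    simp only [sq (Finset.sum _ _), Finset.sum_mul_sum]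
    rw [integral_finsetSum _ fun n _ => integrable_finsetSum _ fun m _ => hint n m]
    simp_rw [integral_finsetSum _ fun m _ => hint _ m, integral_iterate_mul_iterate hS hF]
  rw [hexp]
  have h := sum_sum_dist_le (d := fun k => |∫ x, F x * F (S^[k] x) ∂ν|) (fun _ => abs_nonneg _) M
  have h2 := (Finset.sum_le_sum fun n _ => Finset.sum_le_sum fun m _ =>
    le_abs_self (∫ x, F x * F (S^[Nat.dist n m] x) ∂ν)).trans h
  refine (mul_le_mul_of_nonneg_left h2 (by positivity)).trans (le_of_eq ?_)
  rcases Nat.eq_zero_or_pos M with rfl | hM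
  · simp
  · field_simp

theorem integral_limsup_sq_birkhoffAverage_le {ν : Measure Y} [IsProbabilityMeasure ν] {S : Y → Y}
    (hS : MeasurePreserving S ν ν) {F : Y → ℝ} (hF : Measurable F) (hF1 : ∀ x, |F x| ≤ 1) {M : ℕ}
    (hM : M ≠ 0) :
    ∫ x, limsup (fun n => birkhoffAverage ℝ S F n x ^ 2) atTop ∂ν ≤
      2 * ((M : ℝ)⁻¹ * ∑ k ∈ Finset.range M, |∫ x, F x * F (S^[k] x) ∂ν|) := by
  have hA := abs_birkhoffAverage_le_one S hF1
  have hg0 : ∀ x, 0 ≤ birkhoffAverage ℝ S F M x ^ 2 := fun x => sq_nonneg _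
  have hg1 : ∀ x, birkhoffAverage ℝ S F M x ^ 2 ≤ 1 := fun x =>
    (sq_le_one_iff_abs_le_one _).2 (hA M x)
  have hgm := (measurable_birkhoffAverage hS.measurable hF M).pow_const 2
  have hb := birkhoffAverage_mem_Icc S hg0 hg1
  have hint : Integrable (fun x => limsup (fun n => birkhoffAverage ℝ S
      (fun y => birkhoffAverage ℝ S F M y ^ 2) n x) atTop) ν := by
    refine integrable_of_abs_le_one
      (Measurable.limsup fun n => measurable_birkhoffAverage hS.measurable hgm n) fun x => ?_
    have hbelow : IsBoundedUnder (· ≥ ·) atTop (fun n => birkhoffAverage ℝ S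
      (fun y => birkhoffAverage ℝ S F M y ^ 2) n x) := isBoundedUnder_of ⟨0, fun n => (hb n x).1⟩
    rw [abs_of_nonneg]
    · exact limsup_le_of_le hbelow.isCoboundedUnder_le (Eventually.of_forall fun n => (hb n x).2)
    · exact le_limsup_of_frequently_le (Frequently.of_forall fun n => (hb n x).1)
        (isBoundedUnder_of ⟨1, fun n => (hb n x).2⟩)
  refine (integral_mono_of_nonneg (ae_of_all _ fun x => ?_) hint
    (ae_of_all _ fun x => limsup_sq_birkhoffAverage_le S hF1 hM x)).trans
    ((integral_limsup_birkhoffAverage_le hS hgm hg0 hg1).trans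
      (integral_sq_birkhoffAverage_le hS hF hF1 M))
  exact le_limsup_of_frequently_le (Frequently.of_forall fun n => sq_nonneg _)
    (isBoundedUnder_of ⟨1, fun n => (sq_le_one_iff_abs_le_one _).2 (hA n x)⟩)

theorem measurePreserving_zpow {ν : Measure Y} {T : Equiv.Perm Y}
    (hT : MeasurePreserving (⇑T) ν ν) (hTs : Measurable ⇑T.symm) (k : ℤ) :
    MeasurePreserving (⇑(T ^ k)) ν ν := by
  cases k with
  | ofNat n =>
    rw [Int.ofNat_eq_natCast, zpow_natCast, ← Equiv.Perm.iterate_eq_pow]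
    exact hT.iterate n
  | negSucc n =>
    have hsymm : MeasurePreserving (⇑T⁻¹) ν ν :=
      MeasurePreserving.symm (⟨T, hT.measurable, hTs⟩ : Y ≃ᵐ Y) hT
    rw [zpow_negSucc, ← inv_pow, ← Equiv.Perm.iterate_eq_pow]
    exact hsymm.iterate _

theorem integral_zpow_mul_zpow {ν : Measure Y} {T : Equiv.Perm Y}
    (hT : MeasurePreserving (⇑T) ν ν) (hTs : Measurable ⇑T.symm) {f : Y → ℝ} (hf : Measurable f)
    (i j : ℤ) :
    ∫ x, f ((T ^ i) x) * f ((T ^ j) x) ∂ν = ∫ x, f x * f (T^[(j - i).natAbs] x) ∂ν := by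
  wlog hij : i ≤ j generalizing i j
  · rw [← Int.natAbs_neg, neg_sub, ← this j i (by omega)]
    simp only [mul_comm]
  have hG : Measurable fun x => f x * f (T^[(j - i).natAbs] x) :=
    hf.mul (hf.comp (hT.measurable.iterate _))
  rw [← integral_comp_of_measurePreserving (measurePreserving_zpow hT hTs i) hG]
  have hpow : ∀ x, T^[(j - i).natAbs] ((T ^ i) x) = (T ^ j) x := fun x => by
    rw [Equiv.Perm.iterate_eq_pow, ← zpow_natCast, ← Equiv.Perm.mul_apply, ← zpow_add]
    congr 2
    omega
  simp only [hpow]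

theorem abs_integral_mul_iterate_le_one {ν : Measure Y} [IsProbabilityMeasure ν] (S : Y → Y)
    {f : Y → ℝ} (hf1 : ∀ x, |f x| ≤ 1) (k : ℕ) : |∫ x, f x * f (S^[k] x) ∂ν| ≤ 1 := by
  simpa using norm_integral_le_of_norm_le_const (μ := ν) (f := fun x => f x * f (S^[k] x)) (C := 1)
    (ae_of_all _ fun x => by
      rw [Real.norm_eq_abs, abs_mul]
      exact mul_le_one₀ (hf1 _) (abs_nonneg _) (hf1 _))

/-- Averages along multiples of `q` are controlled by mean squares over all indices. -/
theorem inv_mul_sum_multiples_le {d : ℕ → ℝ} (hd0 : d 0 ≤ 1) {q M : ℕ}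
    (hq : q ≠ 0) (hM : M ≠ 0) {K : ℝ}
    (hK : (1 / ((q * M : ℕ) : ℝ)) * ∑ h ∈ Finset.Icc 1 (q * M), d h ^ 2 ≤ K) :
    (M : ℝ)⁻¹ * ∑ k ∈ Finset.range M, d (q * k) ≤ (M : ℝ)⁻¹ + Real.sqrt (q * K) := by
  have hM0 : (0 : ℝ) < M := by positivity
  have hq0 : (0 : ℝ) < q := by positivity
  have hsplit : ∑ k ∈ Finset.range M, d (q * k) ≤ 1 + ∑ k ∈ Finset.Ico 1 M, d (q * k) := by
    rw [Finset.range_eq_Ico, Finset.sum_eq_sum_Ico_succ_bot (Nat.pos_of_ne_zero hM)]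
    simpa using hd0
  have hsub : ∑ k ∈ Finset.Ico 1 M, d (q * k) ^ 2 ≤ ∑ h ∈ Finset.Icc 1 (q * M), d h ^ 2 := by
    rw [← Finset.sum_image (f := fun h => d h ^ 2) (g := fun k => q * k)
      fun i _ j _ hij => Nat.eq_of_mul_eq_mul_left (Nat.pos_of_ne_zero hq) hij]
    refine Finset.sum_le_sum_of_subset_of_nonneg (fun h hh => ?_) fun _ _ _ => sq_nonneg _
    obtain ⟨k, hk, rfl⟩ := Finset.mem_image.1 hh
    rw [Finset.mem_Ico] at hk
    exact Finset.mem_Icc.2 ⟨Nat.mul_pos (Nat.pos_of_ne_zero hq) hk.1, Nat.mul_le_mul_left q hk.2.le⟩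
  have hcs := sq_sum_le_card_mul_sum_sq (s := Finset.Ico 1 M) (f := fun k => d (q * k))
  have hcard : ((Finset.Ico 1 M).card : ℝ) ≤ M := by simp
  have hK' : ∑ h ∈ Finset.Icc 1 (q * M), d h ^ 2 ≤ K * (q * M) := by
    rwa [one_div, inv_mul_eq_div, div_le_iff₀ (by positivity), Nat.cast_mul] at hK
  have hsq : (∑ k ∈ Finset.Ico 1 M, d (q * k)) ^ 2 ≤ (M : ℝ) ^ 2 * (q * K) := by
    have h0 : 0 ≤ ∑ k ∈ Finset.Ico 1 M, d (q * k) ^ 2 := Finset.sum_nonneg fun _ _ => sq_nonneg _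
    calc _ ≤ _ := hcs
      _ ≤ (M : ℝ) * (K * (q * M)) := mul_le_mul hcard (hsub.trans hK') h0 hM0.le
      _ = _ := by ring
  have hsqrt : ∑ k ∈ Finset.Ico 1 M, d (q * k) ≤ M * Real.sqrt (q * K) := by
    refine (Real.le_sqrt_of_sq_le hsq).trans (le_of_eq ?_)
    rw [Real.sqrt_mul (by positivity), Real.sqrt_sq hM0.le]
  calc _ ≤ (M : ℝ)⁻¹ * (1 + M * Real.sqrt (q * K)) := by gcongr; linarith
    _ = _ := by field_simp

theorem sq_mean_mem_Icc {d : ℕ → ℝ} (hd : ∀ h, |d h| ≤ 1) (H : ℕ) :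
    0 ≤ (1 / (H : ℝ)) * ∑ h ∈ Finset.Icc 1 H, |d h| ^ 2 ∧
      (1 / (H : ℝ)) * ∑ h ∈ Finset.Icc 1 H, |d h| ^ 2 ≤ 1 := by
  refine ⟨by positivity, ?_⟩
  rw [one_div, inv_mul_eq_div]
  refine div_le_one_of_le₀ ?_ (Nat.cast_nonneg H)
  simpa using Finset.sum_le_card_nsmul (Finset.Icc 1 H) (fun h => |d h| ^ 2) 1
    fun h _ => pow_le_one₀ (abs_nonneg _) (hd h)

/-- there is an absolute constant `C > 0` such that for every invertible ergodic
system, all `f₁, f₂` bounded by 1, and integers `a ≠ 0` and `b`,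
`∫∫ limsup_N |(1/N) ∑_{n=1}^N f₁(T^{an}x) f₂(T^{bn}y)|² d(μ⊗μ) ≤ C |a| ⦀f₁⦀₂²`. -/
theorem integral_prod_limsup_sq_avg_le_seminorm2 :
    ∃ C : ℝ, 0 < C ∧
      ∀ {X : Type} [MeasurableSpace X] (μ : Measure X), ∀ [IsProbabilityMeasure μ],
      ∀ (T : Equiv.Perm X), Ergodic (⇑T) μ → Measurable ⇑T.symm →
      ∀ (f₁ f₂ : X → ℝ), Measurable f₁ → Measurable f₂ →
        (∀ x, |f₁ x| ≤ 1) → (∀ x, |f₂ x| ≤ 1) →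
      ∀ (a b : ℤ), a ≠ 0 →
        ∫ p, limsup (fun N : ℕ =>
            |(1 / (N : ℝ)) * ∑ n ∈ Finset.Icc 1 N,
              f₁ ((T ^ (a * (n : ℤ))) p.1) * f₂ ((T ^ (b * (n : ℤ))) p.2)| ^ 2) atTop
          ∂(μ.prod μ)
          ≤ C * |(a : ℝ)| * Real.sqrt (hkSeminorm2pow4 μ (⇑T) f₁) := by
  refine ⟨2, two_pos, ?_⟩
  intro X _ μ _ T hT hTs f₁ f₂ hf₁ hf₂ hb₁ hb₂ a b ha
  have hmp := hT.toMeasurePreserving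
  have hTa := measurePreserving_zpow hmp hTs a
  have hTb := measurePreserving_zpow hmp hTs b
  set S : X × X → X × X := Prod.map ⇑(T ^ a) ⇑(T ^ b) with hSdef
  have hS : MeasurePreserving S (μ.prod μ) (μ.prod μ) := hTa.prod hTb
  let F : X × X → ℝ := fun p => f₁ ((T ^ a) p.1) * f₂ ((T ^ b) p.2)
  have hF : Measurable F := (hf₁.comp (hTa.measurable.comp measurable_fst)).mul
    (hf₂.comp (hTb.measurable.comp measurable_snd))
  have hF1 : ∀ p, |F p| ≤ 1 := fun p => by
    rw [abs_mul]; exact mul_le_one₀ (hb₁ _) (abs_nonneg _) (hb₂ _)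
  have hFS : ∀ n p, F (S^[n] p) =
      f₁ ((T ^ (a * n + a)) p.1) * f₂ ((T ^ (b * n + b)) p.2) := fun n p => by
    simp only [F, hSdef, iterate_prodMap_zpow, ← Equiv.Perm.mul_apply, ← zpow_add, add_comm]
  have havg : ∀ (N : ℕ) (p : X × X), |(1 / (N : ℝ)) * ∑ n ∈ Finset.Icc 1 N,
      f₁ ((T ^ (a * (n : ℤ))) p.1) * f₂ ((T ^ (b * (n : ℤ))) p.2)| ^ 2 =
      birkhoffAverage ℝ S F N p ^ 2 := fun N p => by
    rw [sq_abs, birkhoffAverage, smul_eq_mul, one_div, birkhoffSum,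
      ← Finset.Ico_add_one_right_eq_Icc, Finset.sum_Ico_eq_sum_range, Nat.add_sub_cancel]
    simp only [hFS, Nat.cast_add, Nat.cast_one, mul_add, mul_one, add_comm]
  simp only [havg]
  let d : ℕ → ℝ := fun h => |∫ x, f₁ x * f₁ (T^[h] x) ∂μ|
  have hcorr : ∀ k, |∫ p, F p * F (S^[k] p) ∂(μ.prod μ)| ≤ d (a.natAbs * k) := fun k => by
    have hfac : ∀ p : X × X, F p * F (S^[k] p) =
        (f₁ ((T ^ a) p.1) * f₁ ((T ^ (a * k + a)) p.1)) *
          (f₂ ((T ^ b) p.2) * f₂ ((T ^ (b * k + b)) p.2)) := fun p => by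
      rw [hFS]; simp only [F]; ring
    simp only [hfac]
    rw [integral_prod_mul (fun x => f₁ ((T ^ a) x) * f₁ ((T ^ (a * k + a)) x))
      (fun y => f₂ ((T ^ b) y) * f₂ ((T ^ (b * k + b)) y)),
      integral_zpow_mul_zpow hmp hTs hf₁, integral_zpow_mul_zpow hmp hTs hf₂, abs_mul,
      add_sub_cancel_right, Int.natAbs_mul, Int.natAbs_natCast]
    exact mul_le_of_le_one_right (abs_nonneg _) (abs_integral_mul_iterate_le_one T hb₂ _)
  have hd1 : ∀ h, |∫ x, f₁ x * f₁ (T^[h] x) ∂μ| ≤ 1 := abs_integral_mul_iterate_le_one T hb₁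
  have hmean := sq_mean_mem_Icc hd1
  set K := hkSeminorm2pow4 μ (⇑T) f₁ with hKdef
  have hq : a.natAbs ≠ 0 := Int.natAbs_ne_zero.2 ha
  have hqa : (a.natAbs : ℝ) = |(a : ℝ)| := by rw [Nat.cast_natAbs, Int.cast_abs]
  have hbound : ∀ ε > 0, ∫ p, limsup (fun N => birkhoffAverage ℝ S F N p ^ 2) atTop ∂(μ.prod μ) ≤
      2 * Real.sqrt (a.natAbs * (K + ε)) := fun ε hε => by
    have hev : ∀ᶠ H : ℕ in atTop, (1 / (H : ℝ)) * ∑ h ∈ Finset.Icc 1 H, d h ^ 2 < K + ε :=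
      eventually_lt_of_limsup_lt (show K < K + ε by linarith)
        (isBoundedUnder_of ⟨1, fun H => (hmean H).2⟩)
    have hmul : Tendsto (fun M : ℕ => a.natAbs * M) atTop atTop :=
      tendsto_id.const_mul_atTop' (Nat.pos_of_ne_zero hq)
    have hlim : Tendsto (fun M : ℕ => 2 * ((M : ℝ)⁻¹ + Real.sqrt (a.natAbs * (K + ε)))) atTop
        (𝓝 (2 * (0 + Real.sqrt (a.natAbs * (K + ε))))) :=
      ((tendsto_inv_atTop_nhds_zero_nat (𝕜 := ℝ)).add_const _).const_mul 2
    rw [zero_add] at hlim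
    refine ge_of_tendsto hlim ?_
    filter_upwards [hmul.eventually hev, eventually_ne_atTop 0] with M hM hM0
    refine (integral_limsup_sq_birkhoffAverage_le hS hF hF1 hM0).trans ?_
    have h1 := inv_mul_sum_multiples_le (hd1 0) hq hM0 hM.le
    refine mul_le_mul_of_nonneg_left (le_trans ?_ h1) zero_le_two
    exact mul_le_mul_of_nonneg_left (Finset.sum_le_sum fun k _ => hcorr k) (by positivity)
  have hfinal : ∫ p, limsup (fun N => birkhoffAverage ℝ S F N p ^ 2) atTop ∂(μ.prod μ) ≤
      2 * Real.sqrt (a.natAbs * K) := by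
    have hcont : Tendsto (fun ε : ℝ => 2 * Real.sqrt (a.natAbs * (K + ε))) (𝓝[>] 0)
        (𝓝 (2 * Real.sqrt (a.natAbs * (K + 0)))) :=
      ((by fun_prop : Continuous fun ε : ℝ => 2 * Real.sqrt (a.natAbs * (K + ε))).tendsto
        0).mono_left nhdsWithin_le_nhds
    rw [add_zero] at hcont
    exact ge_of_tendsto hcont (eventually_mem_nhdsWithin.mono hbound)
  have ha1 : (1 : ℝ) ≤ |(a : ℝ)| := by
    rw [← hqa]; exact_mod_cast Nat.pos_of_ne_zero hq
  rw [hqa, Real.sqrt_mul (abs_nonneg _)] at hfinal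
  refine hfinal.trans ?_
  rw [← mul_assoc]
  gcongr
  exact Real.sqrt_le_iff.2 ⟨by positivity, by nlinarith⟩
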